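/- arXiv:math/0610055 — 2 statements merged into one kernel-verified Lean document; each statement's English description precedes it below -/
import Mathlib

section
/- Let X ⊆ ℝⁿ be an open set and let 𝒩 be a continuous round cone family on X. If Z ⊆ X is 𝒩-special, then interior(Z) equals the interior of the closure of Z in X, and interior(Z) is dense in Z, i.e. Z is contained in the closure of interior(Z). -/
open Set

noncomputable section

/-- `ℝⁿ`. -/
abbrev Euc (n : ℕ) : Type := EuclideanSpace ℝ (Fin n)

/-- A round cone in `ℝⁿ`: a closed convex set, stable under nonnegative scalar
multiplication, with nonempty interior, satisfying `N ∩ (-N) = {0}`. -/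
def IsRoundCone {n : ℕ} (N : Set (Euc n)) : Prop :=
  IsClosed N ∧ Convex ℝ N ∧ (∀ c : ℝ, 0 ≤ c → ∀ v ∈ N, c • v ∈ N) ∧
    (interior N).Nonempty ∧ N ∩ (-N) = {0}

/-- The fiber `𝒩ₓ` of a cone family at a point `x`. -/
def coneFiber {n : ℕ} (𝒩 : Set (Euc n × Euc n)) (x : Euc n) : Set (Euc n) :=
  {v | (x, v) ∈ 𝒩}

/-- Restriction `𝒩_V := 𝒩 ∩ (V × ℝⁿ)` of a cone family to a subset `V`. -/
def coneRestrict {n : ℕ} (𝒩 : Set (Euc n × Euc n)) (V : Set (Euc n)) :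
    Set (Euc n × Euc n) :=
  𝒩 ∩ (V ×ˢ (univ : Set (Euc n)))

/-- A continuous round cone family on `X ⊆ ℝⁿ`. -/
structure IsConeFam {n : ℕ} (X : Set (Euc n)) (𝒩 : Set (Euc n × Euc n)) : Prop where
  subset : 𝒩 ⊆ X ×ˢ (univ : Set (Euc n))
  closed : ∃ C : Set (Euc n × Euc n), IsClosed C ∧ 𝒩 = C ∩ (X ×ˢ (univ : Set (Euc n)))
  cone : ∀ x ∈ X, IsRoundCone (coneFiber 𝒩 x)
  lsc : ∀ x ∈ X, ∀ v ∈ interior (coneFiber 𝒩 x),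
    ∃ V : Set (Euc n), IsOpen V ∧ x ∈ V ∧ V ⊆ X ∧ ∀ y ∈ V, v ∈ interior (coneFiber 𝒩 y)

/-- A C¹ arc in `X`, given by `γ` together with its derivative `γ'` on `[0,1]`. -/
structure IsC1ArcIn {n : ℕ} (X : Set (Euc n)) (γ γ' : ℝ → Euc n) : Prop where
  maps : ∀ t ∈ Icc (0:ℝ) 1, γ t ∈ X
  deriv : ∀ t ∈ Icc (0:ℝ) 1, HasDerivWithinAt γ (γ' t) (Icc (0:ℝ) 1) t
  cont : ContinuousOn γ' (Icc (0:ℝ) 1)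

/-- `P ⊆ X` is `𝒩`-invariant: every C¹ arc starting in `P` whose velocity lies in
`𝒩_{γ(t)} \ {0}` stays in `P`. -/
def NInvariant {n : ℕ} (X : Set (Euc n)) (𝒩 : Set (Euc n × Euc n))
    (P : Set (Euc n)) : Prop :=
  ∀ γ γ' : ℝ → Euc n, IsC1ArcIn X γ γ' → γ 0 ∈ P →
    (∀ t ∈ Icc (0:ℝ) 1, γ' t ∈ coneFiber 𝒩 (γ t) \ {0}) →
    ∀ t ∈ Icc (0:ℝ) 1, γ t ∈ P

/-- `𝒩`-open subsets of `X`: open and `𝒩`-invariant. -/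
def NOpen {n : ℕ} (X : Set (Euc n)) (𝒩 : Set (Euc n × Euc n)) (U : Set (Euc n)) : Prop :=
  U ⊆ X ∧ IsOpen U ∧ NInvariant X 𝒩 U

/-- An `𝒩`-smooth function on `V`: a C¹ function with `df_x(τ) < 0` for all
`τ ∈ 𝒩ₓ \ {0}`, `x ∈ V`. -/
def NSmoothOn {n : ℕ} (𝒩 : Set (Euc n × Euc n)) (f : Euc n → ℝ) (V : Set (Euc n)) : Prop :=
  ∃ df : Euc n → (Euc n →L[ℝ] ℝ), ContinuousOn df V ∧ (∀ x ∈ V, HasFDerivAt f (df x) x) ∧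
    ∀ x ∈ V, ∀ τ ∈ coneFiber 𝒩 x \ {0}, df x τ < 0

/-- `P` is `𝒩`-small: some open neighborhood of `P` in `X` admits an `𝒩`-smooth function. -/
def NSmall {n : ℕ} (X : Set (Euc n)) (𝒩 : Set (Euc n × Euc n)) (P : Set (Euc n)) : Prop :=
  ∃ (W : Set (Euc n)) (f : Euc n → ℝ), IsOpen W ∧ P ⊆ W ∧ W ⊆ X ∧ NSmoothOn 𝒩 f W

/-- `Z ⊆ X` is `𝒩`-special: every point of the closure of `Z` in `X` has an open
neighborhood `V ⊆ X` on which, for some continuous round cone family `𝒩'` with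
`𝒩_V ⋐ 𝒩'`, the set `Z ∩ V` is locally closed in the `𝒩'`-topology of `V`. -/
def NSpecial {n : ℕ} (X : Set (Euc n)) (𝒩 : Set (Euc n × Euc n)) (Z : Set (Euc n)) : Prop :=
  Z ⊆ X ∧ ∀ x ∈ closure Z ∩ X, ∃ (V : Set (Euc n)) (𝒩' : Set (Euc n × Euc n)),
    IsOpen V ∧ x ∈ V ∧ V ⊆ X ∧ IsConeFam V 𝒩' ∧
    (∀ y ∈ V, coneFiber (coneRestrict 𝒩 V) y \ {0} ⊆ interior (coneFiber 𝒩' y)) ∧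
    ∃ U₁ U₂ : Set (Euc n), NOpen V 𝒩' U₁ ∧ NOpen V 𝒩' U₂ ∧ Z ∩ V = U₁ \ U₂

/-- An `𝒩`-lens: an `𝒩`-special subset whose closure in `X` is compact and `𝒩`-small. -/
def NLens {n : ℕ} (X : Set (Euc n)) (𝒩 : Set (Euc n × Euc n)) (Z : Set (Euc n)) : Prop :=
  NSpecial X 𝒩 Z ∧ IsCompact (closure Z ∩ X) ∧ NSmall X 𝒩 (closure Z ∩ X)

/-- A (finite) partition of a subset `S`: finitely many pairwise disjoint nonempty
subsets with union `S`. -/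
def IsPartitionOf {α : Type*} (S : Set α) (Ps : Set (Set α)) : Prop :=
  Ps.Finite ∧ (∀ A ∈ Ps, A.Nonempty) ∧
    (∀ A ∈ Ps, ∀ B ∈ Ps, A ≠ B → Disjoint A B) ∧ ⋃₀ Ps = S

/-- A partition of `S` comes from a closed filtration: there is a chain
`∅ = F₀ ⊆ … ⊆ F_m = S` of subsets closed in `S` whose nonempty successive
differences are exactly the members of the partition. -/
def ComesFromClosedFiltration {α : Type*} [TopologicalSpace α] (S : Set α)
    (Ps : Set (Set α)) : Prop :=
  ∃ (m : ℕ) (F : ℕ → Set α), F 0 = ∅ ∧ F m = S ∧ (∀ i < m, F i ⊆ F (i + 1)) ∧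
    (∀ i ≤ m, ∃ C : Set α, IsClosed C ∧ F i = C ∩ S) ∧
    Ps = {A | A.Nonempty ∧ ∃ i, 1 ≤ i ∧ i ≤ m ∧ A = F i \ F (i - 1)}

/-- An `𝒩`-special partition of an `𝒩`-lens `Z`: it comes from a closed filtration
of `Z` and each member is an `𝒩`-lens. -/
def NSpecialPartition {n : ℕ} (X : Set (Euc n)) (𝒩 : Set (Euc n × Euc n))
    (Z : Set (Euc n)) (Ps : Set (Set (Euc n))) : Prop :=
  IsPartitionOf Z Ps ∧ ComesFromClosedFiltration Z Ps ∧ ∀ A ∈ Ps, NLens X 𝒩 A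

/-- `𝒩`-constructible subsets: the smallest collection containing all `𝒩`-lenses and
stable under finite unions, intersections and differences. -/
inductive NConstructible {n : ℕ} (X : Set (Euc n)) (𝒩 : Set (Euc n × Euc n)) :
    Set (Euc n) → Prop
  | lens (Z : Set (Euc n)) : NLens X 𝒩 Z → NConstructible X 𝒩 Z
  | union (A B : Set (Euc n)) :
      NConstructible X 𝒩 A → NConstructible X 𝒩 B → NConstructible X 𝒩 (A ∪ B)
  | inter (A B : Set (Euc n)) :
      NConstructible X 𝒩 A → NConstructible X 𝒩 B → NConstructible X 𝒩 (A ∩ B)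
  | diff (A B : Set (Euc n)) :
      NConstructible X 𝒩 A → NConstructible X 𝒩 B → NConstructible X 𝒩 (A \ B)

/-- Membership in `Par^≺(Y)`: a partition of `Y` all of whose members are `𝒩`-lenses. -/
def ParPrec {n : ℕ} (X : Set (Euc n)) (𝒩 : Set (Euc n × Euc n)) (Y : Set (Euc n))
    (Ps : Set (Set (Euc n))) : Prop :=
  IsPartitionOf Y Ps ∧ ∀ A ∈ Ps, NLens X 𝒩 A

/-- The relation `⪯` on `Par^≺(Y)`: `Ps ⪯ Qs` if `Qs` refines `Ps` and for each member
`A` of `Ps` the members of `Qs` contained in `A` form an `𝒩`-special partition of `A`. -/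
def PrecRel {n : ℕ} (X : Set (Euc n)) (𝒩 : Set (Euc n × Euc n))
    (Ps Qs : Set (Set (Euc n))) : Prop :=
  (∀ B ∈ Qs, ∃ A ∈ Ps, B ⊆ A) ∧
    ∀ A ∈ Ps, NSpecialPartition X 𝒩 A {B | B ∈ Qs ∧ B ⊆ A}

open Topology in
/-- Lower semicontinuity of a cone family, uniformly in the direction. -/
theorem IsConeFam.eventually_mem {n : ℕ} {X : Set (Euc n)} {𝒩 : Set (Euc n × Euc n)}
    (h𝒩 : IsConeFam X 𝒩) {x v : Euc n} (hx : x ∈ X) (hv : v ∈ interior (coneFiber 𝒩 x)) :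
    ∃ W : Set (Euc n), IsOpen W ∧ v ∈ W ∧ ∀ᶠ y in 𝓝 x, W ⊆ coneFiber 𝒩 y := by
  obtain ⟨b, hvb, hb⟩ := exists_mem_interior_convexHull_affineBasis
    (isOpen_interior.mem_nhds hv)
  refine ⟨interior (convexHull ℝ (range b)), isOpen_interior, hvb, ?_⟩
  have hvertex : ∀ i, ∀ᶠ y in 𝓝 x, y ∈ X ∧ b i ∈ coneFiber 𝒩 y := fun i ↦ by
    obtain ⟨V, hVo, hxV, hVX, hV⟩ :=
      h𝒩.lsc x hx (b i) (hb (subset_convexHull ℝ _ (mem_range_self i)))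
    filter_upwards [hVo.mem_nhds hxV] with y hy
    exact ⟨hVX hy, interior_subset (hV y hy)⟩
  filter_upwards [Filter.eventually_all.2 hvertex] with y hy
  refine interior_subset.trans (convexHull_min ?_ (h𝒩.cone y (hy 0).1).2.1)
  rintro _ ⟨i, rfl⟩
  exact (hy i).2

open Topology in
theorem IsRoundCone.zero_notMem_interior {n : ℕ} [Nontrivial (Euc n)] {N : Set (Euc n)}
    (hN : IsRoundCone N) : (0 : Euc n) ∉ interior N := by
  intro h
  have h₁ : N ∈ 𝓝 (0 : Euc n) := mem_interior_iff_mem_nhds.1 h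
  have h₂ : -N ∈ 𝓝 (0 : Euc n) := by
    have : Filter.Tendsto (fun z : Euc n ↦ -z) (𝓝 0) (𝓝 0) := by
      simpa using (continuous_neg (G := Euc n)).tendsto 0
    exact this h₁
  have h₃ := Filter.inter_mem h₁ h₂
  rw [hN.2.2.2.2] at h₃
  exact not_isOpen_singleton (0 : Euc n) (isOpen_singleton_iff_nhds_eq_pure _ |>.2
    (le_antisymm (Filter.le_pure_iff.2 h₃) (pure_le_nhds _)))

/-- An invariant set containing the starting point of a segment whose direction is admissible
along the whole segment contains its endpoint. -/
theorem NInvariant.mem_of_segment {n : ℕ} {X : Set (Euc n)} {𝒩 : Set (Euc n × Euc n)}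
    {U : Set (Euc n)} (hU : NInvariant X 𝒩 U) {w x : Euc n} (hseg : segment ℝ w x ⊆ X)
    (hdir : ∀ y ∈ segment ℝ w x, x - w ∈ coneFiber 𝒩 y) (hne : x - w ≠ 0) (hw : w ∈ U) :
    x ∈ U := by
  have hmem : ∀ t ∈ Icc (0 : ℝ) 1, w + t • (x - w) ∈ segment ℝ w x := fun t ht ↦ by
    rw [segment_eq_image']
    exact mem_image_of_mem _ ht
  have harc : IsC1ArcIn X (fun t ↦ w + t • (x - w)) fun _ ↦ x - w :=
    { maps := fun t ht ↦ hseg (hmem t ht)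
      deriv := fun t _ ↦ by
        simpa using (((hasDerivAt_id t).smul_const (x - w)).const_add w).hasDerivWithinAt
      cont := continuousOn_const }
  simpa using hU _ _ harc (by simpa using hw) (fun t ht ↦ ⟨hdir _ (hmem t ht), hne⟩) 1
    (right_mem_Icc.2 zero_le_one)

open Topology in
/-- Every neighborhood of `x` contains a nonempty open set of points from which `x` can be
reached inside every invariant set. -/
theorem IsConeFam.exists_isOpen_past {n : ℕ} {V : Set (Euc n)} {𝒩 : Set (Euc n × Euc n)}
    (h𝒩 : IsConeFam V 𝒩) (hV : IsOpen V) {x : Euc n} (hx : x ∈ V) {O : Set (Euc n)}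
    (hO : O ∈ 𝓝 x) :
    ∃ G : Set (Euc n), IsOpen G ∧ G.Nonempty ∧ G ⊆ O ∧ G ⊆ V ∧
      ∀ U, NInvariant V 𝒩 U → ∀ w ∈ G, w ∈ U → x ∈ U := by
  rcases subsingleton_or_nontrivial (Euc n) with hn | hn
  · have key : ∀ w : Euc n, w = x := fun w ↦ Subsingleton.elim w x
    exact ⟨univ, isOpen_univ, ⟨x, mem_univ x⟩, fun w _ ↦ key w ▸ mem_of_mem_nhds hO,
      fun w _ ↦ key w ▸ hx, fun U _ w _ hw ↦ key w ▸ hw⟩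
  obtain ⟨v, hv⟩ := (h𝒩.cone x hx).2.2.2.1
  have hv0 : v ≠ 0 := fun h ↦ (h𝒩.cone x hx).zero_notMem_interior (h ▸ hv)
  obtain ⟨W, hWo, hvW, hW⟩ := h𝒩.eventually_mem hx hv
  obtain ⟨r, hr, hball⟩ := Metric.mem_nhds_iff.1
    (Filter.inter_mem (Filter.inter_mem hO (hV.mem_nhds hx)) hW)
  have hlim : Filter.Tendsto (fun ε : ℝ ↦ x - ε • v) (𝓝[>] 0) (𝓝 x) := by
    have : Continuous fun ε : ℝ ↦ x - ε • v := by fun_prop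
    simpa using (this.tendsto 0).mono_left nhdsWithin_le_nhds
  obtain ⟨ε, hεball, hε⟩ :=
    ((hlim.eventually (Metric.ball_mem_nhds x hr)).and self_mem_nhdsWithin).exists
  replace hε : 0 < ε := hε
  refine ⟨Metric.ball x r ∩ (fun w ↦ ε⁻¹ • (x - w)) ⁻¹' (W \ {0}),
    Metric.isOpen_ball.inter ((hWo.sdiff isClosed_singleton).preimage (by fun_prop)),
    ⟨x - ε • v, hεball, ?_⟩, fun w hw ↦ (hball hw.1).1.1, fun w hw ↦ (hball hw.1).1.2, ?_⟩
  · simpa [smul_smul, hε.ne'] using ⟨hvW, hv0⟩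
  · rintro U hU w ⟨hwb, hwW, hw0⟩ hwU
    have hseg : segment ℝ w x ⊆ Metric.ball x r :=
      (convex_ball x r).segment_subset hwb (Metric.mem_ball_self hr)
    refine hU.mem_of_segment (fun y hy ↦ (hball (hseg hy)).1.2) (fun y hy ↦ ?_)
      (fun h ↦ hw0 (by simp [h])) hwU
    have hy' := hball (hseg hy)
    have := (h𝒩.cone y hy'.1.2).2.2.1 ε hε.le _ (hy'.2 hwW)
    rwa [smul_inv_smul₀ hε.ne'] at this

/-- for an `𝒩`-special `Z`, `Int(Z) = Int(closure of Z in X)` and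
`Int(Z)` is dense in `Z`. -/
theorem stmt_9 {n : ℕ} (X : Set (Euc n)) (hX : IsOpen X)
    (𝒩 : Set (Euc n × Euc n)) (h𝒩 : IsConeFam X 𝒩)
    (Z : Set (Euc n)) (hZ : NSpecial X 𝒩 Z) :
    interior Z = interior (closure Z ∩ X) ∧ Z ⊆ closure (interior Z) := by
  obtain ⟨hZX, hloc⟩ := hZ
  have hsub : Z ⊆ closure Z ∩ X := fun z hz ↦ ⟨subset_closure hz, hZX hz⟩
  refine ⟨(interior_mono hsub).antisymm (interior_maximal ?_ isOpen_interior), ?_⟩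
  · intro x hx
    have hxc := interior_subset hx
    obtain ⟨V, 𝒩', hV, hxV, -, h𝒩', -, U₁, U₂, hU₁, hU₂, hZV⟩ := hloc x hxc
    obtain ⟨G, hGo, ⟨g, hg⟩, hGO, hGV, hG⟩ :=
      h𝒩'.exists_isOpen_past hV hxV (isOpen_interior.mem_nhds hx)
    obtain ⟨z, hzG, hzZ⟩ := mem_closure_iff.1 (interior_subset (hGO hg)).1 G hGo hg
    have hz : z ∈ U₁ \ U₂ := hZV ▸ ⟨hzZ, hGV hzG⟩
    have hxU₂ : x ∉ U₂ := fun h ↦ by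
      obtain ⟨y, hy, hyZ⟩ := mem_closure_iff.1 hxc.1 U₂ hU₂.2.1 h
      have hy' : y ∈ U₁ \ U₂ := hZV ▸ ⟨hyZ, hU₂.1 hy⟩
      exact hy'.2 hy
    have hxZ : x ∈ Z ∩ V := hZV ▸ ⟨hG U₁ hU₁.2.2 z hzG hz.1, hxU₂⟩
    exact hxZ.1
  · intro x hx
    obtain ⟨V, 𝒩', hV, hxV, -, h𝒩', -, U₁, U₂, hU₁, hU₂, hZV⟩ := hloc x (hsub hx)
    have hxU : x ∈ U₁ \ U₂ := hZV ▸ ⟨hx, hxV⟩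
    refine mem_closure_iff.2 fun O hO hxO ↦ ?_
    obtain ⟨G, hGo, ⟨g, hg⟩, hGO, -, hG⟩ := h𝒩'.exists_isOpen_past hV hxV
      (Filter.inter_mem (hO.mem_nhds hxO) (hU₁.2.1.mem_nhds hxU.1))
    refine ⟨g, (hGO hg).1, interior_maximal (fun w hw ↦ ?_) hGo hg⟩
    have hwZ : w ∈ Z ∩ V := hZV ▸ ⟨(hGO hw).2, fun h ↦ hxU.2 (hG U₂ hU₂.2.2 w hw h)⟩
    exact hwZ.1
end
end

section
/- Let X ⊆ ℝⁿ be an open set and let 𝒩 be a continuous round cone family on X. The intersection of finitely many 𝒩-special subsets of X is 𝒩-special, and the intersection of finitely many 𝒩-lenses is an 𝒩-lens. -/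
open Set

noncomputable section

theorem coneFiber_inter {n : ℕ} (A B : Set (Euc n × Euc n)) (x : Euc n) :
    coneFiber (A ∩ B) x = coneFiber A x ∩ coneFiber B x := rfl

theorem IsRoundCone.zero_mem {n : ℕ} {N : Set (Euc n)} (h : IsRoundCone N) : (0 : Euc n) ∈ N := by
  have h0 : (0 : Euc n) ∈ N ∩ (-N) := by rw [h.2.2.2.2]; rfl
  exact h0.1

/-- Two round cones whose interiors both contain the nonzero vectors of a third one
intersect in a round cone. -/
theorem IsRoundCone.inter {n : ℕ} {N A B : Set (Euc n)} (hN : IsRoundCone N)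
    (hA : IsRoundCone A) (hB : IsRoundCone B) (hNA : N \ {0} ⊆ interior A)
    (hNB : N \ {0} ⊆ interior B) : IsRoundCone (A ∩ B) := by
  have h0 : (0 : Euc n) ∈ A ∩ B := ⟨hA.zero_mem, hB.zero_mem⟩
  refine ⟨hA.1.inter hB.1, hA.2.1.inter hB.2.1,
    fun c hc v hv => ⟨hA.2.2.1 c hc v hv.1, hB.2.2.1 c hc v hv.2⟩, ?_, ?_⟩
  · rcases subsingleton_or_nontrivial (Euc n) with hsub | hnt
    · have huniv : A ∩ B = univ := Subsingleton.eq_univ_of_nonempty ⟨0, h0⟩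
      rw [huniv, interior_univ]
      exact univ_nonempty
    · obtain ⟨v, hv, hv0⟩ :=
        (dense_compl_singleton (0 : Euc n)).inter_open_nonempty _ isOpen_interior hN.2.2.2.1
      rw [interior_inter]
      exact ⟨v, hNA ⟨interior_subset hv, hv0⟩, hNB ⟨interior_subset hv, hv0⟩⟩
  · refine Subset.antisymm (fun v hv => ?_) ?_
    · rw [← hA.2.2.2.2]
      exact ⟨hv.1.1, hv.2.1⟩
    · rintro _ rfl
      exact ⟨h0, by simpa using h0⟩

theorem IsConeFam.inter {n : ℕ} {V W : Set (Euc n)} {A B : Set (Euc n × Euc n)}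
    (hA : IsConeFam V A) (hB : IsConeFam W B)
    (h : ∀ x ∈ V ∩ W, IsRoundCone (coneFiber (A ∩ B) x)) : IsConeFam (V ∩ W) (A ∩ B) where
  subset := fun _ hp => ⟨⟨(hA.subset hp.1).1, (hB.subset hp.2).1⟩, mem_univ _⟩
  closed := by
    obtain ⟨C, hC, rfl⟩ := hA.closed
    obtain ⟨D, hD, rfl⟩ := hB.closed
    refine ⟨C ∩ D, hC.inter hD, ?_⟩
    ext p
    simp only [mem_inter_iff, mem_prod, mem_univ, and_true]
    tauto
  cone := h
  lsc := by
    intro x hx v hv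
    rw [coneFiber_inter, interior_inter] at hv
    obtain ⟨V', hV', hxV', hV'V, hVv⟩ := hA.lsc x hx.1 v hv.1
    obtain ⟨W', hW', hxW', hW'W, hWv⟩ := hB.lsc x hx.2 v hv.2
    refine ⟨V' ∩ W', hV'.inter hW', ⟨hxV', hxW'⟩, inter_subset_inter hV'V hW'W, ?_⟩
    intro y hy
    rw [coneFiber_inter, interior_inter]
    exact ⟨hVv y hy.1, hWv y hy.2⟩

theorem IsC1ArcIn.mono {n : ℕ} {V W : Set (Euc n)} {γ γ' : ℝ → Euc n} (hVW : V ⊆ W)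
    (h : IsC1ArcIn V γ γ') : IsC1ArcIn W γ γ' :=
  ⟨fun t ht => hVW (h.maps t ht), h.deriv, h.cont⟩

theorem NOpen.restrict {n : ℕ} {V W U : Set (Euc n)} {A B : Set (Euc n × Euc n)}
    (hU : NOpen W B U) (hV : IsOpen V) (hVW : V ⊆ W) (hAB : A ⊆ B) : NOpen V A (U ∩ V) := by
  refine ⟨inter_subset_right, hU.2.1.inter hV, fun γ γ' hγ h0 hγ' t ht => ⟨?_, hγ.maps t ht⟩⟩
  exact hU.2.2 γ γ' (hγ.mono hVW) h0.1 (fun r hr => ⟨hAB (hγ' r hr).1, (hγ' r hr).2⟩) t ht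

theorem NOpen.inter {n : ℕ} {X U V : Set (Euc n)} {A : Set (Euc n × Euc n)}
    (hU : NOpen X A U) (hV : NOpen X A V) : NOpen X A (U ∩ V) :=
  ⟨fun _ hx => hU.1 hx.1, hU.2.1.inter hV.2.1, fun γ γ' hγ h0 hγ' t ht =>
    ⟨hU.2.2 γ γ' hγ h0.1 hγ' t ht, hV.2.2 γ γ' hγ h0.2 hγ' t ht⟩⟩

theorem NOpen.union {n : ℕ} {X U V : Set (Euc n)} {A : Set (Euc n × Euc n)}
    (hU : NOpen X A U) (hV : NOpen X A V) : NOpen X A (U ∪ V) :=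
  ⟨union_subset hU.1 hV.1, hU.2.1.union hV.2.1, fun γ γ' hγ h0 hγ' t ht =>
    h0.imp (fun h => hU.2.2 γ γ' hγ h hγ' t ht) (fun h => hV.2.2 γ γ' hγ h hγ' t ht)⟩

theorem NSpecial.inter {n : ℕ} {X Y Z : Set (Euc n)} {𝒩 : Set (Euc n × Euc n)}
    (h𝒩 : IsConeFam X 𝒩) (hY : NSpecial X 𝒩 Y) (hZ : NSpecial X 𝒩 Z) :
    NSpecial X 𝒩 (Y ∩ Z) := by
  refine ⟨fun _ hx => hY.1 hx.1, fun x hx => ?_⟩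
  obtain ⟨V, A, hV, hxV, hVX, hA, hNA, U₁, U₂, hU₁, hU₂, hYV⟩ :=
    hY.2 x ⟨closure_mono inter_subset_left hx.1, hx.2⟩
  obtain ⟨W, B, hW, hxW, -, hB, hNB, T₁, T₂, hT₁, hT₂, hZW⟩ :=
    hZ.2 x ⟨closure_mono inter_subset_right hx.1, hx.2⟩
  have hA' : ∀ y ∈ V ∩ W, coneFiber 𝒩 y \ {0} ⊆ interior (coneFiber A y) :=
    fun y hy v hv => hNA y hy.1 ⟨⟨hv.1, hy.1, mem_univ _⟩, hv.2⟩
  have hB' : ∀ y ∈ V ∩ W, coneFiber 𝒩 y \ {0} ⊆ interior (coneFiber B y) :=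
    fun y hy v hv => hNB y hy.2 ⟨⟨hv.1, hy.2, mem_univ _⟩, hv.2⟩
  have hVW : IsOpen (V ∩ W) := hV.inter hW
  refine ⟨V ∩ W, A ∩ B, hVW, ⟨hxV, hxW⟩, fun _ hy => hVX hy.1,
    hA.inter hB fun y hy =>
      (h𝒩.cone y (hVX hy.1)).inter (hA.cone y hy.1) (hB.cone y hy.2) (hA' y hy) (hB' y hy),
    ?_, (U₁ ∩ (V ∩ W)) ∩ (T₁ ∩ (V ∩ W)), (U₂ ∩ (V ∩ W)) ∪ (T₂ ∩ (V ∩ W)),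
    (hU₁.restrict hVW inter_subset_left inter_subset_left).inter
      (hT₁.restrict hVW inter_subset_right inter_subset_right),
    (hU₂.restrict hVW inter_subset_left inter_subset_left).union
      (hT₂.restrict hVW inter_subset_right inter_subset_right), ?_⟩
  · intro y hy v hv
    rw [coneFiber_inter, interior_inter]
    exact ⟨hA' y hy ⟨hv.1.1, hv.2⟩, hB' y hy ⟨hv.1.1, hv.2⟩⟩
  · ext y
    have h₁ := Set.ext_iff.mp hYV y
    have h₂ := Set.ext_iff.mp hZW y
    simp only [mem_inter_iff, mem_sdiff, mem_union] at h₁ h₂ ⊢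
    tauto

theorem NLens.inter {n : ℕ} {X Y Z : Set (Euc n)} {𝒩 : Set (Euc n × Euc n)}
    (h𝒩 : IsConeFam X 𝒩) (hY : NLens X 𝒩 Y) (hZ : NLens X 𝒩 Z) : NLens X 𝒩 (Y ∩ Z) := by
  have hsub : closure (Y ∩ Z) ∩ X ⊆ closure Y ∩ X :=
    inter_subset_inter_left X (closure_mono inter_subset_left)
  refine ⟨hY.1.inter h𝒩 hZ.1, ?_, ?_⟩
  · have heq : closure (Y ∩ Z) ∩ X = (closure Y ∩ X) ∩ closure (Y ∩ Z) :=
      Subset.antisymm (fun _ hy => ⟨hsub hy, hy.1⟩) fun _ hy => ⟨hy.2, hy.1.2⟩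
    rw [heq]
    exact hY.2.1.inter_right isClosed_closure
  · obtain ⟨W, f, hW, hYW, hWX, hf⟩ := hY.2.2
    exact ⟨W, f, hW, hsub.trans hYW, hWX, hf⟩

/-- A property of sets stable under binary intersections is stable under nonempty finite
intersections. -/
theorem biInter_finset_of_inter {α ι : Type*} {p : Set α → Prop}
    (hp : ∀ A B, p A → p B → p (A ∩ B)) {s : Finset ι} (hs : s.Nonempty) (Z : ι → Set α)
    (h : ∀ i ∈ s, p (Z i)) : p (⋂ i ∈ s, Z i) := by
  induction hs using Finset.Nonempty.cons_induction with
  | singleton a => simpa using h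
  | cons a s ha hs ih =>
    rw [Finset.forall_mem_cons] at h
    have heq : ⋂ i ∈ Finset.cons a s ha, Z i = Z a ∩ ⋂ i ∈ s, Z i := by
      ext x
      simp
    rw [heq]
    exact hp _ _ h.1 (ih h.2)

/-- finite intersections of `𝒩`-special sets are `𝒩`-special; finite
intersections of `𝒩`-lenses are `𝒩`-lenses. -/
theorem stmt_12 {n : ℕ} (X : Set (Euc n)) (hX : IsOpen X)
    (𝒩 : Set (Euc n × Euc n)) (h𝒩 : IsConeFam X 𝒩)
    {ι : Type*} (s : Finset ι) (hs : s.Nonempty) (Z : ι → Set (Euc n)) :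
    ((∀ i ∈ s, NSpecial X 𝒩 (Z i)) → NSpecial X 𝒩 (⋂ i ∈ s, Z i)) ∧
    ((∀ i ∈ s, NLens X 𝒩 (Z i)) → NLens X 𝒩 (⋂ i ∈ s, Z i)) := by
  exact ⟨biInter_finset_of_inter (fun _ _ => NSpecial.inter h𝒩) hs Z,
    biInter_finset_of_inter (fun _ _ => NLens.inter h𝒩) hs Z⟩
end
end
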